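/- In any LTS, semi-branching apartness satisfies the apartness stuttering property: if r ↠τ q ↠τ t and q #_sb p, then r #_sb p or t #_sb p. -/

import Mathlib

/-- `TauCl tau` is the reflexive-transitive closure `↠τ` of the silent-step relation. -/
def TauCl {X : Type*} (tau : X → X → Prop) : X → X → Prop := Relation.ReflTransGen tau

/-- `Q` is a semi-branching apartness on the LTS `(tau, step)`. -/
def IsSemiBranchingApartness {X A : Type*} (tau : X → X → Prop) (step : A → X → X → Prop)
    (Q : X → X → Prop) : Prop :=
  (∀ q p, Q p q → Q q p) ∧
  (∀ q q' p, tau q q' → Q q' p →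
    (∀ p' p'', TauCl tau p p' → tau p' p'' → Q q' p'' ∨ (Q q p' ∧ Q q p'')) → Q q p) ∧
  (∀ q q' p a, step a q q' →
    (∀ p' p'', TauCl tau p p' → step a p' p'' → Q q p' ∨ Q q' p'') → Q q p)

/-- `q` and `p` are semi-branching apart: related by every semi-branching apartness. -/
def SbApart {X A : Type*} (tau : X → X → Prop) (step : A → X → X → Prop) (q p : X) : Prop :=
  ∀ Q, IsSemiBranchingApartness tau step Q → Q q p

/-- A symmetric relation is a semi-branching bisimulation if every silent step is matched by silent
steps followed by at most one further silent step, and every visible step is matched up to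
preceding silent steps. -/
structure IsSemiBranchingBisimulation {X A : Type*} (tau : X → X → Prop) (step : A → X → X → Prop)
    (R : X → X → Prop) : Prop where
  symm : ∀ q p, R p q → R q p
  tau_step : ∀ q q' p, R q p → tau q q' →
    ∃ p' p'', TauCl tau p p' ∧ (p' = p'' ∨ tau p' p'') ∧ R q p' ∧ R q' p''
  vis_step : ∀ q q' p a, R q p → step a q q' →
    ∃ p' p'', TauCl tau p p' ∧ step a p' p'' ∧ R q p' ∧ R q' p''

section

variable {X A : Type*} {tau : X → X → Prop} {step : A → X → X → Prop}

theorem IsSemiBranchingApartness.isSemiBranchingBisimulation_not {Q : X → X → Prop}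
    (hQ : IsSemiBranchingApartness tau step Q) :
    IsSemiBranchingBisimulation tau step (fun q p => ¬ Q q p) := by
  obtain ⟨hs, ht, hv⟩ := hQ
  refine ⟨fun q p h h' => h (hs p q h'), fun q q' p h hqq' => ?_, fun q q' p a h hqq' => ?_⟩
  · by_cases hq'p : Q q' p
    · by_contra hne
      refine h (ht q q' p hqq' hq'p fun p' p'' hp hp' => ?_)
      by_contra hn
      rw [not_or, not_and_or] at hn
      obtain ⟨h₁, h₂ | h₂⟩ := hn
      · exact hne ⟨p', p'', hp, .inr hp', h₂, h₁⟩
      · exact hne ⟨p'', p'', hp.tail hp', .inl rfl, h₂, h₁⟩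
    · exact ⟨p, p, .refl, .inl rfl, h, hq'p⟩
  · by_contra hne
    refine h (hv q q' p a hqq' fun p' p'' hp hp' => ?_)
    by_contra hn
    rw [not_or] at hn
    exact hne ⟨p', p'', hp, hp', hn⟩

theorem IsSemiBranchingBisimulation.isSemiBranchingApartness_not {R : X → X → Prop}
    (hR : IsSemiBranchingBisimulation tau step R) :
    IsSemiBranchingApartness tau step (fun q p => ¬ R q p) := by
  refine ⟨fun q p h h' => h (hR.symm p q h'), fun q q' p hqq' hq'p hall h => ?_,
    fun q q' p a hqq' hall h => ?_⟩
  · obtain ⟨p', p'', hp, hp' | hp', h₁, h₂⟩ := hR.tau_step q q' p h hqq'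
    · subst hp'
      rcases Relation.ReflTransGen.cases_tail hp with heq | ⟨x, hpx, hx⟩
      · exact hq'p (heq ▸ h₂)
      · rcases hall x p' hpx hx with h₃ | h₃
        · exact h₃ h₂
        · exact h₃.2 h₁
    · rcases hall p' p'' hp hp' with h₃ | h₃
      · exact h₃ h₂
      · exact h₃.1 h₁
  · obtain ⟨p', p'', hp, hp', h₁, h₂⟩ := hR.vis_step q q' p a h hqq'
    exact (hall p' p'' hp hp').elim (· h₁) (· h₂)

theorem IsSemiBranchingBisimulation.exists_tauCl {R : X → X → Prop}
    (hR : IsSemiBranchingBisimulation tau step R) {r q p : X} (hrq : TauCl tau r q)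
    (hrp : R r p) : ∃ p', TauCl tau p p' ∧ R q p' := by
  induction hrq with
  | refl => exact ⟨p, .refl, hrp⟩
  | tail _ hbc ih =>
    obtain ⟨p₁, hp₁, hb⟩ := ih
    obtain ⟨p', p'', hp', rfl | hp'', -, hc⟩ := hR.tau_step _ _ _ hb hbc
    · exact ⟨p', Relation.ReflTransGen.trans hp₁ hp', hc⟩
    · exact ⟨p'', Relation.ReflTransGen.trans hp₁ (hp'.tail hp''), hc⟩

/-- The state `q` lies on a silent path between two states that are both related to `p`. -/
def StutterRel (tau R : X → X → Prop) (q p : X) : Prop :=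
  ∃ r t, TauCl tau r q ∧ TauCl tau q t ∧ R r p ∧ R t p

theorem StutterRel.of_rel {R : X → X → Prop} {q p : X} (h : R q p) : StutterRel tau R q p :=
  ⟨q, q, .refl, .refl, h, h⟩

theorem IsSemiBranchingBisimulation.stutterRel {R : X → X → Prop}
    (hR : IsSemiBranchingBisimulation tau step R) :
    IsSemiBranchingBisimulation tau step
      (fun q p => StutterRel tau R q p ∨ StutterRel tau R p q) := by
  have reach : ∀ q p, StutterRel tau R q p ∨ StutterRel tau R p q →
      ∃ p', TauCl tau p p' ∧ R q p' := by
    rintro q p (⟨r, t, hrq, -, hr, -⟩ | ⟨r, t, -, hpt, -, ht⟩)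
    · exact hR.exists_tauCl hrq hr
    · exact ⟨t, hpt, hR.symm _ _ ht⟩
  refine ⟨fun q p h => h.symm, fun q q' p h hqq' => ?_, fun q q' p a h hqq' => ?_⟩ <;>
    obtain ⟨p₁, hp₁, hq⟩ := reach q p h
  · obtain ⟨p', p'', hp', hp'', h₁, h₂⟩ := hR.tau_step q q' p₁ hq hqq'
    exact ⟨p', p'', Relation.ReflTransGen.trans hp₁ hp', hp'', .inl (.of_rel h₁),
      .inl (.of_rel h₂)⟩
  · obtain ⟨p', p'', hp', hp'', h₁, h₂⟩ := hR.vis_step q q' p₁ a hq hqq'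
    exact ⟨p', p'', Relation.ReflTransGen.trans hp₁ hp', hp'', .inl (.of_rel h₁),
      .inl (.of_rel h₂)⟩

theorem isSemiBranchingApartness_sbApart :
    IsSemiBranchingApartness tau step (SbApart tau step) := by
  refine ⟨fun q p h Q hQ => hQ.1 q p (h Q hQ), fun q q' p hqq' hq'p hall Q hQ => ?_,
    fun q q' p a hqq' hall Q hQ => ?_⟩
  · exact hQ.2.1 q q' p hqq' (hq'p Q hQ) fun p' p'' hp hp' =>
      (hall p' p'' hp hp').imp (· Q hQ) fun h => ⟨h.1 Q hQ, h.2 Q hQ⟩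
  · exact hQ.2.2 q q' p a hqq' fun p' p'' hp hp' =>
      (hall p' p'' hp hp').imp (· Q hQ) (· Q hQ)

end

theorem sbApart_stuttering {X A : Type*} (tau : X → X → Prop) (step : A → X → X → Prop)
    (r q t p : X) (hrq : TauCl tau r q) (hqt : TauCl tau q t)
    (h : SbApart tau step q p) :
    SbApart tau step r p ∨ SbApart tau step t p := by
  by_contra hn
  rw [not_or] at hn
  have hR := (isSemiBranchingApartness_sbApart (tau := tau)
    (step := step)).isSemiBranchingBisimulation_not.stutterRel
  exact h _ hR.isSemiBranchingApartness_not (.inl ⟨r, t, hrq, hqt, hn⟩)
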